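/- Let H be a complex Hilbert space and A : H → H a bounded self-adjoint positive operator (⟨Ax, x⟩ ≥ 0 for all x ∈ H). For real r ≥ 0 let A^r denote the fractional power defined by the continuous functional calculus applied to x ↦ x^r (with 0^0 = 1 and 0^r = 0 for r > 0). Then for all real numbers 0 ≤ α < β < γ and every φ ∈ H, the moment inequality holds: ‖A^{β} φ‖ ≤ ‖A^{α} φ‖^{(γ-β)/(γ-α)} · ‖A^{γ} φ‖^{(β-α)/(γ-α)}. -/

import Mathlib

open scoped InnerProductSpace in
theorem re_inner_cfc_mul_self {H : Type*} [NormedAddCommGroup H] [InnerProductSpace ℂ H]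
    [CompleteSpace H] (A : H →L[ℂ] H) (f : ℝ → ℝ) (hf : ContinuousOn f (spectrum ℝ A)) (φ : H) :
    (⟪cfc (fun x => f x * f x) A φ, φ⟫_ℂ).re = ‖cfc f A φ‖ ^ 2 := by
  have hs : IsSelfAdjoint (cfc f A) := cfc_predicate f A
  rw [cfc_mul f f A hf hf, mul_apply_eq_comp]
  have h := ContinuousLinearMap.adjoint_inner_left (cfc f A) φ (cfc f A φ)
  rw [hs.adjoint_eq] at h
  rw [h, inner_self_eq_norm_sq_to_K]
  norm_cast

theorem norm_sq_cfc_le {H : Type*} [NormedAddCommGroup H] [InnerProductSpace ℂ H]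
    [CompleteSpace H] (A : H →L[ℂ] H) (f g h : ℝ → ℝ)
    (hf : ContinuousOn f (spectrum ℝ A)) (hg : ContinuousOn g (spectrum ℝ A))
    (hh : ContinuousOn h (spectrum ℝ A)) (s t : ℝ)
    (hle : ∀ x ∈ spectrum ℝ A, g x * g x ≤ s * (f x * f x) + t * (h x * h x)) (φ : H) :
    ‖cfc g A φ‖ ^ 2 ≤ s * ‖cfc f A φ‖ ^ 2 + t * ‖cfc h A φ‖ ^ 2 := by
  have hff := hf.mul hf
  have hhh := hh.mul hh
  have hmono := cfc_mono (a := A) hle (hg.mul hg)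
    ((continuousOn_const.mul hff).add (continuousOn_const.mul hhh))
  rw [cfc_add A (fun x => s * (f x * f x)) (fun x => t * (h x * h x))
      (continuousOn_const.mul hff) (continuousOn_const.mul hhh),
    cfc_const_mul s (fun x => f x * f x) A hff,
    cfc_const_mul t (fun x => h x * h x) A hhh, ContinuousLinearMap.le_def] at hmono
  have hre := hmono.re_inner_nonneg_left φ
  simp only [sub_apply, add_apply,
    smul_apply, inner_sub_left, inner_add_left, inner_smul_left_eq_smul,
    RCLike.re_to_complex, Complex.sub_re, Complex.add_re, Complex.smul_re, smul_eq_mul,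
    re_inner_cfc_mul_self A f hf, re_inner_cfc_mul_self A g hg,
    re_inner_cfc_mul_self A h hh] at hre
  linarith

theorem rpow_mul_self_le_weighted {x a c p q α γ : ℝ} (hx : 0 ≤ x) (ha : 0 < a) (hc : 0 < c)
    (hp : 0 ≤ p) (hq : 0 ≤ q) (hpq : p + q = 1) (hα : 0 ≤ α) (hγ : 0 ≤ γ) :
    x ^ (p * α + q * γ) * x ^ (p * α + q * γ) ≤
      a ^ p * c ^ q * p / a * (x ^ α * x ^ α) + a ^ p * c ^ q * q / c * (x ^ γ * x ^ γ) := by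
  have hxα : 0 ≤ x ^ α := Real.rpow_nonneg hx _
  have hxγ : 0 ≤ x ^ γ := Real.rpow_nonneg hx _
  have young := Real.geom_mean_le_arith_mean2_weighted hp hq
    (div_nonneg (mul_nonneg hxα hxα) ha.le) (div_nonneg (mul_nonneg hxγ hxγ) hc.le) hpq
  have hap : 0 < a ^ p := Real.rpow_pos_of_pos ha _
  have hcq : 0 < c ^ q := Real.rpow_pos_of_pos hc _
  rw [Real.div_rpow (mul_nonneg hxα hxα) ha.le, Real.div_rpow (mul_nonneg hxγ hxγ) hc.le,
    Real.mul_rpow hxα hxα, Real.mul_rpow hxγ hxγ, ← Real.rpow_mul hx, ← Real.rpow_mul hx] at young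
  rw [Real.rpow_add_of_nonneg hx (mul_nonneg hp hα) (mul_nonneg hq hγ), mul_comm p α,
    mul_comm q γ]
  generalize a ^ p = u at *
  generalize c ^ q = v at *
  calc x ^ (α * p) * x ^ (γ * q) * (x ^ (α * p) * x ^ (γ * q))
      = u * v * (x ^ (α * p) * x ^ (α * p) / u * (x ^ (γ * q) * x ^ (γ * q) / v)) := by
        generalize x ^ (α * p) = y
        generalize x ^ (γ * q) = z
        field_simp
    _ ≤ u * v * (p * (x ^ α * x ^ α / a) + q * (x ^ γ * x ^ γ / c)) :=
        mul_le_mul_of_nonneg_left young (mul_pos hap hcq).le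
    _ = u * v * p / a * (x ^ α * x ^ α) + u * v * q / c * (x ^ γ * x ^ γ) := by ring

theorem moment_inequality
    (H : Type*) [NormedAddCommGroup H] [InnerProductSpace ℂ H] [CompleteSpace H]
    (A : H →L[ℂ] H) (hA : IsSelfAdjoint A)
    (hpos : ∀ x : H, 0 ≤ (inner ℂ (A x) x : ℂ).re)
    (α β γ : ℝ) (hα : 0 ≤ α) (hαβ : α < β) (hβγ : β < γ) (φ : H) :
    ‖cfc (fun x : ℝ => x ^ β) A φ‖ ≤
      ‖cfc (fun x : ℝ => x ^ α) A φ‖ ^ ((γ - β) / (γ - α)) *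
        ‖cfc (fun x : ℝ => x ^ γ) A φ‖ ^ ((β - α) / (γ - α)) := by
  have hA0 : 0 ≤ A := by
    rw [ContinuousLinearMap.nonneg_iff_isPositive, ContinuousLinearMap.isPositive_def']
    exact ⟨hA, hpos⟩
  have hspec : ∀ x ∈ spectrum ℝ A, 0 ≤ x := fun x hx => spectrum_nonneg_of_nonneg hA0 hx
  have hcont (r : ℝ) (hr : 0 ≤ r) : ContinuousOn (fun x : ℝ => x ^ r) (spectrum ℝ A) :=
    (Real.continuous_rpow_const hr).continuousOn
  have hd : 0 < γ - α := by linarith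
  set p := (γ - β) / (γ - α) with hp_def
  set q := (β - α) / (γ - α) with hq_def
  have hp : 0 < p := div_pos (by linarith) hd
  have hq : 0 < q := div_pos (by linarith) hd
  have hpq : p + q = 1 := by rw [hp_def, hq_def]; field_simp; ring
  have hβ : p * α + q * γ = β := by rw [hp_def, hq_def]; field_simp; ring
  set a := ‖cfc (fun x : ℝ => x ^ α) A φ‖
  set b := ‖cfc (fun x : ℝ => x ^ β) A φ‖
  set c := ‖cfc (fun x : ℝ => x ^ γ) A φ‖
  have ha : 0 ≤ a := norm_nonneg _
  have hc : 0 ≤ c := norm_nonneg _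
  have key : ∀ ε : ℝ, 0 < ε → b ^ 2 ≤ (a ^ 2 + ε) ^ p * (c ^ 2 + ε) ^ q := by
    intro ε hε
    have ha' : 0 < a ^ 2 + ε := by positivity
    have hc' : 0 < c ^ 2 + ε := by positivity
    set K := (a ^ 2 + ε) ^ p * (c ^ 2 + ε) ^ q with hK_def
    have hK : 0 ≤ K := by positivity
    have hle : b ^ 2 ≤ K * p / (a ^ 2 + ε) * a ^ 2 + K * q / (c ^ 2 + ε) * c ^ 2 := by
      refine norm_sq_cfc_le A _ _ _ (hcont α hα) (hcont β (by linarith))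
        (hcont γ (by linarith)) _ _ (fun x hx => ?_) φ
      simpa only [hβ] using rpow_mul_self_le_weighted (hspec x hx) ha' hc' hp.le hq.le hpq hα
        (by linarith : 0 ≤ γ)
    have hwa : K * p / (a ^ 2 + ε) * a ^ 2 ≤ K * p := by
      rw [div_mul_eq_mul_div, div_le_iff₀ ha']
      exact mul_le_mul_of_nonneg_left (by linarith) (by positivity)
    have hwc : K * q / (c ^ 2 + ε) * c ^ 2 ≤ K * q := by
      rw [div_mul_eq_mul_div, div_le_iff₀ hc']
      exact mul_le_mul_of_nonneg_left (by linarith) (by positivity)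
    calc b ^ 2 ≤ K * p + K * q := by linarith
      _ = K := by rw [← mul_add, hpq, mul_one]
  have hlim : Filter.Tendsto (fun ε : ℝ => (a ^ 2 + ε) ^ p * (c ^ 2 + ε) ^ q)
      (nhdsWithin 0 (Set.Ioi 0)) (nhds ((a ^ 2) ^ p * (c ^ 2) ^ q)) := by
    have hcts : Continuous fun ε : ℝ => (a ^ 2 + ε) ^ p * (c ^ 2 + ε) ^ q :=
      ((continuous_const.add continuous_id).rpow_const fun _ => Or.inr hp.le).mul
        ((continuous_const.add continuous_id).rpow_const fun _ => Or.inr hq.le)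
    simpa using (hcts.tendsto 0).mono_left nhdsWithin_le_nhds
  have hsq : b ^ 2 ≤ (a ^ 2) ^ p * (c ^ 2) ^ q :=
    ge_of_tendsto hlim (Filter.eventually_of_mem self_mem_nhdsWithin key)
  rw [← Real.rpow_pow_comm ha, ← Real.rpow_pow_comm hc, ← mul_pow] at hsq
  exact le_of_sq_le_sq hsq (by positivity)
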